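/- Let (α, μ) be a measure space, let p > 2, ε > 0, B > 0 and λ ≥ 0 be reals, and let v : α → ℝ be measurable with ∫ |v|^{p+ε} dμ ≤ (B·λ)^{p+ε}. Then (1/p) · ∫_{{|v| ≥ 1}} |v|^p · log|v| dμ ≤ (B^{p+ε}/(e·ε·p)) · λ^{p+ε}; consequently, λ²/2 − (1/p) · ∫_{{|v| ≥ 1}} |v|^p · log|v| dμ ≥ G(λ), where G(λ) := λ²/2 − (B^{p+ε}/(e·ε·p))·λ^{p+ε}. -/

import Mathlib

open MeasureTheory

/-- The sharp bound `log t ≤ t ^ ε / (e ε)`, attained at `t = e ^ (1 / ε)`. -/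
theorem Real.log_le_rpow_div_exp_one_mul {t ε : ℝ} (ht : 0 < t) (hε : 0 < ε) :
    Real.log t ≤ t ^ ε / (Real.exp 1 * ε) := by
  have h := Real.add_one_le_exp (ε * Real.log t - 1)
  rw [Real.exp_sub, mul_comm ε, ← Real.rpow_def_of_pos ht, sub_add_cancel] at h
  rwa [← div_div, le_div_iff₀ hε]

/-- The entropy-type integral of `|v| ^ p * log |v|` over `{|v| ≥ 1}` is controlled by the
integral of `|v| ^ (p + ε)`. -/
theorem setIntegral_rpow_mul_log_le {α : Type*} [MeasurableSpace α] {μ : Measure α}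
    {p ε : ℝ} (hε : 0 < ε) {v : α → ℝ} (hv : Measurable v)
    (hint : Integrable (fun x => |v x| ^ (p + ε)) μ) :
    ∫ x in {x | 1 ≤ |v x|}, |v x| ^ p * Real.log |v x| ∂μ ≤
      (∫ x, |v x| ^ (p + ε) ∂μ) / (Real.exp 1 * ε) := by
  have hS : MeasurableSet {x | 1 ≤ |v x|} := measurableSet_le measurable_const hv.abs
  rw [← integral_div]
  have hint' : Integrable (fun x => |v x| ^ (p + ε) / (Real.exp 1 * ε)) μ := hint.div_const _
  refine (integral_mono_of_nonneg ?_ hint'.integrableOn ?_).trans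
    (setIntegral_le_integral hint' (Filter.Eventually.of_forall fun x => by positivity))
  · filter_upwards [ae_restrict_mem hS] with x hx
    exact mul_nonneg (by positivity) (Real.log_nonneg hx)
  · filter_upwards [ae_restrict_mem hS] with x hx
    have hpos : 0 < |v x| := one_pos.trans_le hx
    rw [Real.rpow_add hpos, mul_div_assoc]
    gcongr
    exact Real.log_le_rpow_div_exp_one_mul hpos hε

/-- Measure-theoretic core of Lemma 2.6: if `∫ |v|^(p+ε) ≤ (B λ)^(p+ε)`, then the
logarithmic potential term is controlled and the energy `λ²/2` minus this term is
bounded below by `G(λ) = λ²/2 − (B^(p+ε)/(e ε p)) λ^(p+ε)`. -/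
theorem energy_lower_bound {α : Type*} [MeasurableSpace α] (μ : Measure α)
    (p ε B lam : ℝ) (hp : 2 < p) (hε : 0 < ε) (hB : 0 < B) (hlam : 0 ≤ lam)
    (v : α → ℝ) (hv : Measurable v)
    (hint : Integrable (fun x => |v x| ^ (p + ε)) μ)
    (hbound : ∫ x, |v x| ^ (p + ε) ∂μ ≤ (B * lam) ^ (p + ε)) :
    (1 / p) * ∫ x in {x | 1 ≤ |v x|}, |v x| ^ p * Real.log |v x| ∂μ ≤
        B ^ (p + ε) / (Real.exp 1 * ε * p) * lam ^ (p + ε) ∧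
      lam ^ 2 / 2 - (1 / p) * ∫ x in {x | 1 ≤ |v x|}, |v x| ^ p * Real.log |v x| ∂μ ≥
        lam ^ 2 / 2 - B ^ (p + ε) / (Real.exp 1 * ε * p) * lam ^ (p + ε) := by
  have hp0 : 0 < p := by linarith
  have key : (1 / p) * ∫ x in {x | 1 ≤ |v x|}, |v x| ^ p * Real.log |v x| ∂μ ≤
      B ^ (p + ε) / (Real.exp 1 * ε * p) * lam ^ (p + ε) :=
    calc
      _ ≤ (1 / p) * ((B * lam) ^ (p + ε) / (Real.exp 1 * ε)) := by
        gcongr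
        exact (setIntegral_rpow_mul_log_le hε hv hint).trans (by gcongr)
      _ = _ := by
        rw [Real.mul_rpow hB.le hlam]
        field_simp
  exact ⟨key, sub_le_sub_left key _⟩
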